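/- Fix n ≥ 2, w ∈ S_n, and k ∈ {1,…,n−1}. Then max_k(w) ≤ min{ValPair_k(w), PosPair_k(w)} + 1. -/

import Mathlib

/-- The simple reflection `σ_i = (i, i+1)`, acting on `ℕ` (1-indexed positions/values). -/
def simpleRefl (i : ℕ) : Equiv.Perm ℕ := Equiv.swap i (i + 1)

/-- `w` is a permutation of `{1, …, n}`: it fixes every point outside `[1, n]`. -/
def IsPermOf (n : ℕ) (w : Equiv.Perm ℕ) : Prop :=
  ∀ x : ℕ, x ∉ Finset.Icc 1 n → w x = x

/-- The Coxeter length of `w`: its number of inversions on `{1, …, n}`. -/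
def len (n : ℕ) (w : Equiv.Perm ℕ) : ℕ :=
  ((Finset.Icc 1 n ×ˢ Finset.Icc 1 n).filter fun p => p.1 < p.2 ∧ w p.2 < w p.1).card

/-- `L` is a word for `w`: a list of indices in `[1, n-1]` whose associated product of
simple reflections (read left to right) is `w`. -/
def IsWord (n : ℕ) (w : Equiv.Perm ℕ) (L : List ℕ) : Prop :=
  (∀ i ∈ L, 1 ≤ i ∧ i ≤ n - 1) ∧ (L.map simpleRefl).prod = w

/-- `L` is a reduced decomposition of `w`. -/
def IsReducedWord (n : ℕ) (w : Equiv.Perm ℕ) (L : List ℕ) : Prop :=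
  IsWord n w L ∧ L.length = len n w

/-- `min_k(w)`: the minimum number of occurrences of `σ_k` in a reduced decomposition of `w`. -/
noncomputable def minOcc (n k : ℕ) (w : Equiv.Perm ℕ) : ℕ :=
  sInf {m | ∃ L : List ℕ, IsReducedWord n w L ∧ L.count k = m}

/-- `max_k(w)`: the maximum number of occurrences of `σ_k` in a reduced decomposition of `w`. -/
noncomputable def maxOcc (n k : ℕ) (w : Equiv.Perm ℕ) : ℕ :=
  sSup {m | ∃ L : List ℕ, IsReducedWord n w L ∧ L.count k = m}

/-- `expat_k(w) = |{w(1),…,w(k)} ∩ {k+1,…,n}|`. -/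
def expat (n k : ℕ) (w : Equiv.Perm ℕ) : ℕ :=
  (((Finset.Icc 1 k).image fun i => w i) ∩ Finset.Icc (k + 1) n).card

/-- A `321`-pattern of `w` in positions `i1 < i2 < i3` (within `[1, n]`). -/
def Is321At (n : ℕ) (w : Equiv.Perm ℕ) (i1 i2 i3 : ℕ) : Prop :=
  1 ≤ i1 ∧ i1 < i2 ∧ i2 < i3 ∧ i3 ≤ n ∧ w i3 < w i2 ∧ w i2 < w i1

/-- A `3412`-pattern of `w` in positions `i1 < i2 < i3 < i4` (within `[1, n]`). -/
def Is3412At (n : ℕ) (w : Equiv.Perm ℕ) (i1 i2 i3 i4 : ℕ) : Prop :=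
  1 ≤ i1 ∧ i1 < i2 ∧ i2 < i3 ∧ i3 < i4 ∧ i4 ≤ n ∧
    w i3 < w i4 ∧ w i4 < w i1 ∧ w i1 < w i2

/-- `p` is a position pair at `k`: `p = (i1, i3)` for a `321`-pattern with `i1 ≤ k < i3`,
or `p = (i2, i3)` for a `3412`-pattern with `i2 ≤ k < i3`. -/
def IsPosPair (n k : ℕ) (w : Equiv.Perm ℕ) (p : ℕ × ℕ) : Prop :=
  (∃ i2, Is321At n w p.1 i2 p.2 ∧ p.1 ≤ k ∧ k < p.2) ∨
  (∃ i1 i4, Is3412At n w i1 p.1 p.2 i4 ∧ p.1 ≤ k ∧ k < p.2)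

/-- `p` is a value pair at `k`: `p = (j3, j1)` for a `321`-pattern with values
`j1 < j2 < j3` and `j1 ≤ k < j3`, or `p = (j4, j1)` for a `3412`-pattern with values
`j1 < j2 < j3 < j4` and `j2 ≤ k < j3`. -/
def IsValPair (n k : ℕ) (w : Equiv.Perm ℕ) (p : ℕ × ℕ) : Prop :=
  (∃ i1 i2 i3, Is321At n w i1 i2 i3 ∧ w i3 ≤ k ∧ k < w i1 ∧ p = (w i1, w i3)) ∨
  (∃ i1 i2 i3 i4, Is3412At n w i1 i2 i3 i4 ∧ w i4 ≤ k ∧ k < w i1 ∧ p = (w i2, w i3))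

/-- `PosPair_k(w)`: the number of distinct position pairs at `k` in `w`. -/
noncomputable def posPairCount (n k : ℕ) (w : Equiv.Perm ℕ) : ℕ :=
  Set.ncard {p : ℕ × ℕ | IsPosPair n k w p}

/-- `ValPair_k(w)`: the number of distinct value pairs at `k` in `w`. -/
noncomputable def valPairCount (n k : ℕ) (w : Equiv.Perm ℕ) : ℕ :=
  Set.ncard {p : ℕ × ℕ | IsValPair n k w p}

lemma simpleRefl_apply (i x : ℕ) :
    simpleRefl i x = if x = i then i + 1 else if x = i + 1 then i else x := by
  simp [simpleRefl, Equiv.swap_apply_def]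

lemma simpleRefl_lt (i x y : ℕ) (h : x < y) (hne : ¬ (x = i ∧ y = i + 1)) :
    simpleRefl i x < simpleRefl i y := by
  rw [simpleRefl_apply, simpleRefl_apply]
  split_ifs <;> omega

lemma simpleRefl_le_iff (i k x : ℕ) (h : i ≠ k) : simpleRefl i x ≤ k ↔ x ≤ k := by
  rw [simpleRefl_apply]
  split_ifs <;> omega

lemma simpleRefl_range (n i x : ℕ) (h1 : 1 ≤ i) (h2 : i ≤ n - 1) (hx : 1 ≤ x ∧ x ≤ n) :
    1 ≤ simpleRefl i x ∧ simpleRefl i x ≤ n := by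
  rw [simpleRefl_apply]
  split_ifs <;> omega

lemma simpleRefl_invol (i x : ℕ) : simpleRefl i (simpleRefl i x) = x := by
  simp [simpleRefl]

def invSet (n : ℕ) (w : Equiv.Perm ℕ) : Finset (ℕ × ℕ) :=
  (Finset.Icc 1 n ×ˢ Finset.Icc 1 n).filter fun p => p.1 < p.2 ∧ w p.2 < w p.1

lemma mem_invSet (n : ℕ) (w : Equiv.Perm ℕ) (p : ℕ × ℕ) :
    p ∈ invSet n w ↔ ((1 ≤ p.1 ∧ p.1 ≤ n) ∧ (1 ≤ p.2 ∧ p.2 ≤ n)) ∧ p.1 < p.2 ∧ w p.2 < w p.1 := by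
  simp [invSet]

lemma inv_erase_le (n i : ℕ) (w : Equiv.Perm ℕ) (h1 : 1 ≤ i) (h2 : i ≤ n - 1) :
    ((invSet n (w * simpleRefl i)).erase (i, i + 1)).card ≤ len n w := by
  change _ ≤ (invSet n w).card
  apply Finset.card_le_card_of_injOn (fun p => (simpleRefl i p.1, simpleRefl i p.2))
  · intro p hp
    simp only [Finset.coe_erase, Set.mem_sdiff, Finset.mem_coe, mem_invSet, Set.mem_singleton_iff,
      Equiv.Perm.mul_apply] at hp ⊢
    obtain ⟨⟨⟨ha, hb⟩, hc, hd⟩, he⟩ := hp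
    refine ⟨⟨simpleRefl_range n i _ h1 h2 ha, simpleRefl_range n i _ h1 h2 hb⟩, ?_, hd⟩
    apply simpleRefl_lt _ _ _ hc
    rintro ⟨e1, e2⟩
    exact he (Prod.ext e1 e2)
  · intro p _ q _ h
    simp only [Prod.mk.injEq, EmbeddingLike.apply_eq_iff_eq] at h
    exact Prod.ext h.1 h.2

lemma len_mul_le (n i : ℕ) (w : Equiv.Perm ℕ) (h1 : 1 ≤ i) (h2 : i ≤ n - 1) :
    len n (w * simpleRefl i) ≤ len n w + 1 := by
  have h := inv_erase_le n i w h1 h2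
  have := Finset.pred_card_le_card_erase (s := invSet n (w * simpleRefl i)) (a := (i, i + 1))
  change (invSet n (w * simpleRefl i)).card ≤ _
  omega

lemma len_mul_le' (n i : ℕ) (w : Equiv.Perm ℕ) (h1 : 1 ≤ i) (h2 : i ≤ n - 1)
    (h : w (i + 1) < w i) : len n (w * simpleRefl i) ≤ len n w := by
  have h := inv_erase_le n i w h1 h2
  rwa [Finset.erase_eq_of_notMem] at h
  simp [mem_invSet, simpleRefl_apply]
  omega

lemma len_word_le (n : ℕ) (L : List ℕ) (hL : ∀ i ∈ L, 1 ≤ i ∧ i ≤ n - 1) :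
    len n (L.map simpleRefl).prod ≤ L.length := by
  induction L using List.reverseRecOn with
  | nil =>
    simp only [len, List.map_nil, List.prod_nil, Equiv.Perm.one_apply, List.length_nil,
      Nat.le_zero, Finset.card_eq_zero, Finset.filter_eq_empty_iff]
    intro p _ hp
    omega
  | append_singleton L i ih =>
    have hi := hL i (by simp)
    have := ih (fun j hj => hL j (by simp [hj]))
    have := len_mul_le n i (L.map simpleRefl).prod hi.1 hi.2
    simp only [List.map_append, List.map_cons, List.map_nil, List.prod_append, List.prod_cons,
      List.prod_nil, mul_one, List.length_append, List.length_cons, List.length_nil]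
    omega

lemma posPair_ne (n k i : ℕ) (w : Equiv.Perm ℕ) (h1 : 1 ≤ i) (h2 : i ≤ n - 1) (hik : i ≠ k)
    (hasc : w i < w (i + 1)) (p : ℕ × ℕ) (hp : IsPosPair n k w p) :
    IsPosPair n k (w * simpleRefl i) (simpleRefl i p.1, simpleRefl i p.2) := by
  obtain ⟨p, q⟩ := p
  have ho : ∀ x y, x < y → w y < w x → simpleRefl i x < simpleRefl i y := by
    intro x y hxy hw
    apply simpleRefl_lt _ _ _ hxy
    rintro ⟨rfl, rfl⟩
    omega
  have hr := fun x => simpleRefl_range n i x h1 h2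
  have hk := fun x => simpleRefl_le_iff i k x hik
  simp only [IsPosPair, Is321At, Is3412At, Equiv.Perm.mul_apply] at hp ⊢
  rcases hp with ⟨c, ⟨a1, a2, a3, a4, a5, a6⟩, a7, a8⟩ |
    ⟨c, d, ⟨a1, a2, a3, a4, a5, a6, a7, a8⟩, a9, a10⟩
  · left
    refine ⟨simpleRefl i c, ?_⟩
    simp only [simpleRefl_invol]
    have := hk p
    have := hk q
    have := hr p (by omega)
    have := hr q (by omega)
    have := ho p c a2 a6
    have := ho c q a3 a5
    omega
  · have := hk p
    have := hk q
    have := hr p (by omega)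
    have := hr q (by omega)
    have := hr c (by omega)
    have := hr d (by omega)
    have := ho p q (by omega) (by omega)
    have := ho c q (by omega) (by omega)
    have := ho p d (by omega) (by omega)
    by_cases hcp : c = i ∧ p = i + 1
    · left
      refine ⟨simpleRefl i c, ?_⟩
      simp only [simpleRefl_invol]
      have : simpleRefl i p < simpleRefl i c := by
        obtain ⟨rfl, rfl⟩ := hcp
        simp [simpleRefl]
      omega
    · by_cases hqd : q = i ∧ d = i + 1
      · left
        refine ⟨simpleRefl i d, ?_⟩
        simp only [simpleRefl_invol]
        have : simpleRefl i d < simpleRefl i q := by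
          obtain ⟨rfl, rfl⟩ := hqd
          simp [simpleRefl]
        omega
      · right
        refine ⟨simpleRefl i c, simpleRefl i d, ?_⟩
        simp only [simpleRefl_invol]
        have := simpleRefl_lt i c p (by omega) hcp
        have := simpleRefl_lt i q d (by omega) hqd
        omega

lemma posPair_eq (n k : ℕ) (w : Equiv.Perm ℕ) (h1 : 1 ≤ k) (h2 : k ≤ n - 1)
    (hasc : w k < w (k + 1)) (p : ℕ × ℕ) (hp : IsPosPair n k w p) :
    IsPosPair n k (w * simpleRefl k) p := by
  obtain ⟨p, q⟩ := p
  have e1 : (w * simpleRefl k) k = w (k + 1) := by simp [simpleRefl]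
  have e2 : (w * simpleRefl k) (k + 1) = w k := by simp [simpleRefl]
  have e3 : ∀ x, x ≠ k → x ≠ k + 1 → (w * simpleRefl k) x = w x := by
    intro x hx hx'
    simp [simpleRefl_apply, hx, hx']
  generalize w * simpleRefl k = v at *
  have hpq : 1 ≤ p ∧ p ≤ k ∧ k < q ∧ q ≤ n ∧ w q < w p := by
    rcases hp with ⟨c, ⟨a1, a2, a3, a4, a5, a6⟩, a7, a8⟩ |
      ⟨c, d, ⟨a1, a2, a3, a4, a5, a6, a7, a8⟩, a9, a10⟩ <;> dsimp only at * <;> omega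
  by_cases hpk : p = k
  · subst hpk
    have : q ≠ p + 1 := by rintro rfl; omega
    have := e3 q (by omega) this
    left
    refine ⟨p + 1, ?_⟩
    simp only [Is321At]
    omega
  by_cases hqk : q = k + 1
  · subst hqk
    have := e3 p (by omega) (by omega)
    left
    refine ⟨k, ?_⟩
    simp only [Is321At]
    omega
  have ep := e3 p (by omega) (by omega)
  have eq := e3 q (by omega) (by omega)
  rcases hp with ⟨c, ⟨a1, a2, a3, a4, a5, a6⟩, a7, a8⟩ |
      ⟨c, d, ⟨a1, a2, a3, a4, a5, a6, a7, a8⟩, a9, a10⟩ <;> dsimp only at *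
  · left
    by_cases hck : c = k
    · subst hck
      refine ⟨c + 1, ?_⟩
      simp only [Is321At]
      omega
    by_cases hck' : c = k + 1
    · subst hck'
      refine ⟨k, ?_⟩
      simp only [Is321At]
      omega
    have := e3 c hck hck'
    refine ⟨c, ?_⟩
    simp only [Is321At]
    omega
  · right
    have := e3 c (by omega) (by omega)
    have := e3 d (by omega) (by omega)
    refine ⟨c, d, ?_⟩
    simp only [Is3412At]
    omega

lemma exists_max_image (n : ℕ) (w : Equiv.Perm ℕ) (P : ℕ → Prop) (hP : ∀ x, P x → x ≤ n)
    (h : ∃ x, P x) : ∃ x, P x ∧ ∀ y, P y → w y ≤ w x := by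
  have hf : {x | P x}.Finite := (Set.finite_Iic n).subset hP
  exact Set.exists_max_image {x | P x} w hf h

lemma exists_min_image (n : ℕ) (w : Equiv.Perm ℕ) (P : ℕ → Prop) (hP : ∀ x, P x → x ≤ n)
    (h : ∃ x, P x) : ∃ x, P x ∧ ∀ y, P y → w x ≤ w y := by
  have hf : {x | P x}.Finite := (Set.finite_Iic n).subset hP
  exact Set.exists_min_image {x | P x} w hf h

lemma posPair_new (n k : ℕ) (w : Equiv.Perm ℕ) (h1 : 1 ≤ k) (h2 : k ≤ n - 1)
    (hasc : w k < w (k + 1))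
    (hc : ∃ p q, 1 ≤ p ∧ p ≤ k ∧ k < q ∧ q ≤ n ∧ w q < w p) :
    ∃ p, IsPosPair n k (w * simpleRefl k) p ∧ ¬ IsPosPair n k w p := by
  have e1 : (w * simpleRefl k) k = w (k + 1) := by simp [simpleRefl]
  have e2 : (w * simpleRefl k) (k + 1) = w k := by simp [simpleRefl]
  have e3 : ∀ x, x ≠ k → x ≠ k + 1 → (w * simpleRefl k) x = w x := by
    intro x hx hx'
    simp [simpleRefl_apply, hx, hx']
  generalize w * simpleRefl k = v at *
  by_cases hA : ∃ q, k < q ∧ q ≤ n ∧ w q < w k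
  · obtain ⟨q, ⟨b1, b2, b3⟩, hq⟩ := exists_max_image n w (fun q => k < q ∧ q ≤ n ∧ w q < w k)
      (fun x hx => hx.2.1) hA
    have hne : q ≠ k + 1 := by rintro rfl; omega
    have := e3 q (by omega) hne
    refine ⟨(k, q), Or.inl ⟨k + 1, ?_⟩, ?_⟩
    · simp only [Is321At]
      omega
    · rintro (⟨c, ⟨a1, a2, a3, a4, a5, a6⟩, a7, a8⟩ |
        ⟨c, d, ⟨a1, a2, a3, a4, a5, a6, a7, a8⟩, a9, a10⟩) <;> dsimp only at *
      · have := hq c (by omega)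
        omega
      · have := hq d (by omega)
        omega
  by_cases hB : ∃ p, 1 ≤ p ∧ p ≤ k ∧ w (k + 1) < w p
  · obtain ⟨p, ⟨b1, b2, b3⟩, hp⟩ := exists_min_image n w
      (fun p => 1 ≤ p ∧ p ≤ k ∧ w (k + 1) < w p) (fun x hx => by omega) hB
    have hne : p ≠ k := by rintro rfl; omega
    have := e3 p hne (by omega)
    refine ⟨(p, k + 1), Or.inl ⟨k, ?_⟩, ?_⟩
    · simp only [Is321At]
      omega
    · rintro (⟨c, ⟨a1, a2, a3, a4, a5, a6⟩, a7, a8⟩ |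
        ⟨c, d, ⟨a1, a2, a3, a4, a5, a6, a7, a8⟩, a9, a10⟩) <;> dsimp only at *
      · have := hp c (by omega)
        omega
      · have := hp c (by omega)
        omega
  obtain ⟨p, q, c1, c2, c3, c4, c5⟩ := hc
  push Not at hA hB
  have hq := hA q c3 c4
  have hp := hB p c1 c2
  have hpk : p ≠ k := by rintro rfl; omega
  have hqk : q ≠ k + 1 := by rintro rfl; omega
  have i1 : w p ≠ w (k + 1) := fun h => by have := w.injective h; omega
  have i2 : w q ≠ w k := fun h => by have := w.injective h; omega
  have := e3 p hpk (by omega)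
  have := e3 q (by omega) hqk
  refine ⟨(k, k + 1), Or.inr ⟨p, q, ?_⟩, ?_⟩
  · simp only [Is3412At]
    omega
  · rintro (⟨c, ⟨a1, a2, a3, a4, a5, a6⟩, a7, a8⟩ |
        ⟨c, d, ⟨a1, a2, a3, a4, a5, a6, a7, a8⟩, a9, a10⟩) <;> dsimp only at * <;> omega

lemma posPair_finite (n k : ℕ) (w : Equiv.Perm ℕ) : {p : ℕ × ℕ | IsPosPair n k w p}.Finite := by
  apply ((Set.finite_Iic n).prod (Set.finite_Iic n)).subset
  rintro ⟨p, q⟩ (⟨c, ⟨a1, a2, a3, a4, a5, a6⟩, a7, a8⟩ |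
        ⟨c, d, ⟨a1, a2, a3, a4, a5, a6, a7, a8⟩, a9, a10⟩) <;> dsimp only at * <;>
    simp only [Set.mem_prod, Set.mem_Iic] <;> omega

lemma count_le_pos (n k : ℕ) (hk1 : 1 ≤ k) (hk2 : k ≤ n - 1) (L : List ℕ)
    (hL : ∀ i ∈ L, 1 ≤ i ∧ i ≤ n - 1) (hlen : L.length = len n (L.map simpleRefl).prod) :
    L.count k ≤ posPairCount n k (L.map simpleRefl).prod + 1 ∧
    (0 < L.count k → ∃ p q, 1 ≤ p ∧ p ≤ k ∧ k < q ∧ q ≤ n ∧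
      (L.map simpleRefl).prod q < (L.map simpleRefl).prod p) := by
  induction L using List.reverseRecOn with
  | nil => simp
  | append_singleton L i ih =>
    have hi := hL i (by simp)
    have hL' : ∀ j ∈ L, 1 ≤ j ∧ j ≤ n - 1 := fun j hj => hL j (by simp [hj])
    have l1 := len_word_le n L hL'
    simp only [List.map_append, List.map_cons, List.map_nil, List.prod_append, List.prod_cons,
      List.prod_nil, mul_one, List.length_append, List.length_cons, List.length_nil] at hlen ⊢
    have l2 := len_mul_le n i (L.map simpleRefl).prod hi.1 hi.2
    obtain ⟨ih1, ih2⟩ := ih hL' (by omega)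
    generalize (L.map simpleRefl).prod = w at *
    have hasc : w i < w (i + 1) := by
      rcases lt_trichotomy (w i) (w (i + 1)) with h | h | h
      · exact h
      · have := w.injective h
        omega
      · have := len_mul_le' n i w hi.1 hi.2 h
        omega
    by_cases hik : i = k
    · subst hik
      have hsub : {p | IsPosPair n i w p} ⊆ {p | IsPosPair n i (w * simpleRefl i) p} :=
        fun p hp => posPair_eq n i w hi.1 hi.2 hasc p hp
      have hle : posPairCount n i w ≤ posPairCount n i (w * simpleRefl i) :=
        Set.ncard_le_ncard hsub (posPair_finite _ _ _)
      simp only [List.count_append, List.count_singleton_self]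
      refine ⟨?_, fun _ => ⟨i, i + 1, hi.1, le_rfl, by omega, by omega, by
        simpa [simpleRefl] using hasc⟩⟩
      by_cases h0 : L.count i = 0
      · omega
      · obtain ⟨p, hp1, hp2⟩ := posPair_new n i w hi.1 hi.2 hasc (ih2 (by omega))
        have : posPairCount n i w < posPairCount n i (w * simpleRefl i) := by
          apply Set.ncard_lt_ncard _ (posPair_finite _ _ _)
          exact ⟨hsub, fun h => hp2 (h hp1)⟩
        omega
    · have hcount : (L ++ [i]).count k = L.count k := by
        simp [List.count_append, hik]
      rw [hcount]
      have hle : posPairCount n k w ≤ posPairCount n k (w * simpleRefl i) := by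
        apply Set.ncard_le_ncard_of_injOn (fun p => (simpleRefl i p.1, simpleRefl i p.2))
          (fun p hp => posPair_ne n k i w hi.1 hi.2 hik hasc p hp) _ (posPair_finite _ _ _)
        intro p _ q _ h
        simp only [Prod.mk.injEq, EmbeddingLike.apply_eq_iff_eq] at h
        exact Prod.ext h.1 h.2
      refine ⟨by omega, fun h => ?_⟩
      obtain ⟨p, q, c1, c2, c3, c4, c5⟩ := ih2 h
      have := simpleRefl_le_iff i k p hik
      have := simpleRefl_le_iff i k q hik
      have := simpleRefl_range n i p hi.1 hi.2 (by omega)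
      have := simpleRefl_range n i q hi.1 hi.2 (by omega)
      refine ⟨simpleRefl i p, simpleRefl i q, by omega, by omega, by omega, by omega, ?_⟩
      simpa [simpleRefl_invol] using c5

lemma perm_inv_self (w : Equiv.Perm ℕ) (x : ℕ) : w⁻¹ (w x) = x := w.symm_apply_apply x

lemma perm_self_inv (w : Equiv.Perm ℕ) (x : ℕ) : w (w⁻¹ x) = x := w.apply_symm_apply x

lemma perm_range (n : ℕ) (w : Equiv.Perm ℕ) (hw : IsPermOf n w) (x : ℕ) (hx : 1 ≤ x ∧ x ≤ n) :
    1 ≤ w x ∧ w x ≤ n := by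
  by_contra h
  have h2 := hw (w x) (by simpa using h)
  have := w.injective h2
  rw [this] at h
  exact h hx

lemma perm_inv (n : ℕ) (w : Equiv.Perm ℕ) (hw : IsPermOf n w) : IsPermOf n w⁻¹ := by
  intro x hx
  rw [Equiv.Perm.inv_eq_iff_eq]
  exact (hw x hx).symm

lemma len_le_inv (n : ℕ) (w : Equiv.Perm ℕ) (hw : IsPermOf n w) : len n w ≤ len n w⁻¹ := by
  change (invSet n w).card ≤ (invSet n w⁻¹).card
  apply Finset.card_le_card_of_injOn (fun p => (w p.2, w p.1))
  · intro p hp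
    simp only [Finset.mem_coe, mem_invSet, perm_inv_self] at hp ⊢
    exact ⟨⟨perm_range n w hw _ hp.1.2, perm_range n w hw _ hp.1.1⟩, hp.2.2, hp.2.1⟩
  · intro p _ q _ h
    simp only [Prod.mk.injEq, EmbeddingLike.apply_eq_iff_eq] at h
    exact Prod.ext h.2 h.1

/-- target relation for the injection -/
def PairRel (n : ℕ) (v : Equiv.Perm ℕ) (a g : ℕ × ℕ) : Prop :=
  ((∃ c, Is321At n v a.1 c a.2) ∧ g = (a.2, a.1)) ∨
  ((¬ ∃ c, Is321At n v a.1 c a.2) ∧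
    (1 ≤ g.2 ∧ g.2 < a.1 ∧ a.2 < g.1 ∧ g.1 ≤ n ∧ v a.2 < v g.1 ∧ v g.1 < v g.2 ∧ v g.2 < v a.1) ∧
    (∀ p', g.2 < p' → p' < a.1 → ∀ q', a.2 < q' → q' ≤ n →
      ¬ (v a.2 < v q' ∧ v q' < v p' ∧ v p' < v a.1)) ∧
    (∀ q', a.2 < q' → q' < g.1 → ¬ (v a.2 < v q' ∧ v q' < v g.2)))

lemma rel_exists (n k : ℕ) (v : Equiv.Perm ℕ) (a : ℕ × ℕ) (h : IsPosPair n k v a) :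
    ∃ g, PairRel n v a g := by
  classical
  obtain ⟨x, y⟩ := a
  by_cases h3 : ∃ c, Is321At n v x c y
  · exact ⟨(y, x), Or.inl ⟨h3, rfl⟩⟩
  rcases h with ⟨c, hc, _⟩ | ⟨c, d, ⟨a1, a2, a3, a4, a5, a6, a7, a8⟩, a9, a10⟩
  · exact absurd ⟨c, hc⟩ h3
  dsimp only at *
  let P : ℕ → Prop := fun p => 1 ≤ p ∧ p < x ∧ ∃ q, y < q ∧ q ≤ n ∧ v y < v q ∧ v q < v p ∧ v p < v x
  have hP : P c := ⟨a1, a2, d, a4, a5, a6, a7, a8⟩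
  have hpP : P (Nat.findGreatest P x) := Nat.findGreatest_spec a2.le hP
  have hpm : ∀ p', P p' → p' ≤ Nat.findGreatest P x :=
    fun p' hp' => Nat.le_findGreatest hp'.2.1.le hp'
  generalize Nat.findGreatest P x = p at *
  obtain ⟨b1, b2, hq⟩ := hpP
  have hqs := Nat.find_spec hq
  have hqm := fun m => Nat.find_min (m := m) hq
  generalize Nat.find hq = q at *
  refine ⟨(q, p), Or.inr ⟨h3, ?_, ?_, ?_⟩⟩ <;> dsimp only
  · omega
  · intro p' c1 c2 q' c3 c4 c5
    have := hpm p' ⟨by omega, c2, q', c3, c4, c5⟩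
    omega
  · intro q' c1 c2 c3
    exact hqm q' c2 ⟨c1, by omega, c3.1, c3.2, by omega⟩

lemma rel_not321 (n k : ℕ) (v : Equiv.Perm ℕ) (a g : ℕ × ℕ)
    (h3 : ¬ ∃ c, Is321At n v a.1 c a.2) (ha : 1 ≤ a.1 ∧ a.1 ≤ k ∧ k < a.2 ∧ a.2 ≤ n)
    (h : PairRel n v a g) : ¬ ∃ c, Is321At n v g.2 c g.1 := by
  rintro ⟨c, hc⟩
  simp only [Is321At] at hc
  rcases h with ⟨h, _⟩ | ⟨_, h1, h2, h4⟩
  · exact h3 h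
  rcases lt_trichotomy c a.1 with hl | rfl | hl
  · exact h2 c (by omega) hl g.1 (by omega) (by omega) (by omega)
  · omega
  rcases lt_trichotomy c a.2 with hm | rfl | hm
  · exact h3 ⟨c, by simp only [Is321At]; omega⟩
  · omega
  · exact h4 c (by omega) (by omega) (by omega)

lemma posPair_bounds (n k : ℕ) (v : Equiv.Perm ℕ) (a : ℕ × ℕ) (h : IsPosPair n k v a) :
    1 ≤ a.1 ∧ a.1 ≤ k ∧ k < a.2 ∧ a.2 ≤ n := by
  rcases h with (⟨c, ⟨a1, a2, a3, a4, a5, a6⟩, a7, a8⟩ |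
        ⟨c, d, ⟨a1, a2, a3, a4, a5, a6, a7, a8⟩, a9, a10⟩) <;> omega

lemma rel_inj (n k : ℕ) (v : Equiv.Perm ℕ) (a b g : ℕ × ℕ)
    (ha : IsPosPair n k v a) (hb : IsPosPair n k v b) (hag : PairRel n v a g) (hbg : PairRel n v b g) :
    a = b := by
  have ba := posPair_bounds n k v a ha
  have bb := posPair_bounds n k v b hb
  by_cases h3a : ∃ c, Is321At n v a.1 c a.2
  · rcases hag with ⟨_, h⟩ | ⟨h, _⟩
    swap
    · exact absurd h3a h
    by_cases h3b : ∃ c, Is321At n v b.1 c b.2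
    · rcases hbg with ⟨_, h'⟩ | ⟨h', _⟩
      swap
      · exact absurd h3b h'
      rw [h, Prod.mk.injEq] at h'
      exact Prod.ext h'.2 h'.1
    · have := rel_not321 n k v b g h3b bb hbg
      rw [h] at this
      exact absurd h3a this
  by_cases h3b : ∃ c, Is321At n v b.1 c b.2
  · rcases hbg with ⟨_, h⟩ | ⟨h, _⟩
    swap
    · exact absurd h3b h
    have := rel_not321 n k v a g h3a ba hag
    rw [h] at this
    exact absurd h3b this
  rcases hag with ⟨h, _⟩ | ⟨_, p1, p2, p3⟩
  · exact absurd h h3a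
  rcases hbg with ⟨h, _⟩ | ⟨_, q1, q2, q3⟩
  · exact absurd h h3b
  obtain ⟨x, y⟩ := a
  obtain ⟨x', y'⟩ := b
  obtain ⟨q, p⟩ := g
  dsimp only at *
  have key1 : ∀ x y x' : ℕ, x < x' → x' < y → 1 ≤ x → y ≤ n → (¬ ∃ c, Is321At n v x c y) →
      v y < v x' → v x < v x' := by
    intro x y x' d1 d2 d3 d4 h d5
    have : v x ≠ v x' := fun h => by have := v.injective h; omega
    by_contra h'
    exact h ⟨x', by simp only [Is321At]; omega⟩
  have key2 : ∀ x y' y : ℕ, x < y → y < y' → 1 ≤ x → y' ≤ n → (¬ ∃ c, Is321At n v x c y') →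
      v y < v x → v y < v y' := by
    intro x y' y d1 d2 d3 d4 h d5
    have : v y ≠ v y' := fun h => by have := v.injective h; omega
    by_contra h'
    exact h ⟨y, by simp only [Is321At]; omega⟩
  have hx : x = x' := by
    rcases lt_trichotomy x x' with h | h | h
    · have := key1 x y x' h (by omega) (by omega) (by omega) h3a (by omega)
      exact absurd (by omega) (q2 x (by omega) h q (by omega) (by omega))
    · exact h
    · have := key1 x' y' x h (by omega) (by omega) (by omega) h3b (by omega)
      exact absurd (by omega) (p2 x' (by omega) h q (by omega) (by omega))
  have hy : y = y' := by
    rcases lt_trichotomy y y' with h | h | h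
    · have := key2 x' y' y (by omega) h (by omega) (by omega) h3b (by omega)
      exact absurd (by omega) (p3 y' (by omega) (by omega))
    · exact h
    · have := key2 x y y' (by omega) h (by omega) (by omega) h3a (by omega)
      exact absurd (by omega) (q3 y (by omega) (by omega))
  rw [hx, hy]

lemma rel_val (n k : ℕ) (w : Equiv.Perm ℕ) (hw : IsPermOf n w) (a g : ℕ × ℕ)
    (ha : IsPosPair n k w⁻¹ a) (h : PairRel n w⁻¹ a g) : IsValPair n k w g := by
  have ba := posPair_bounds n k _ a ha
  have r1 := perm_range n _ (perm_inv n w hw) a.1 (by omega)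
  have r2 := perm_range n _ (perm_inv n w hw) a.2 (by omega)
  rcases h with ⟨⟨c, hc⟩, rfl⟩ | ⟨_, h, _⟩
  · left
    simp only [Is321At] at hc
    refine ⟨w⁻¹ a.2, w⁻¹ c, w⁻¹ a.1, ?_⟩
    simp only [Is321At, perm_self_inv, and_true]
    omega
  · right
    refine ⟨w⁻¹ a.2, w⁻¹ g.1, w⁻¹ g.2, w⁻¹ a.1, ?_⟩
    simp only [Is3412At, perm_self_inv, and_true]
    omega

lemma valPair_finite (n k : ℕ) (w : Equiv.Perm ℕ) (hw : IsPermOf n w) :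
    {p : ℕ × ℕ | IsValPair n k w p}.Finite := by
  apply ((Set.finite_Iic n).prod (Set.finite_Iic n)).subset
  rintro p (⟨i1, i2, i3, ⟨a1, a2, a3, a4, _⟩, _, _, rfl⟩ |
        ⟨i1, i2, i3, i4, ⟨a1, a2, a3, a4, a5, _⟩, _, _, rfl⟩) <;>
    simp only [Set.mem_prod, Set.mem_Iic]
  · exact ⟨(perm_range n w hw _ (by omega)).2, (perm_range n w hw _ (by omega)).2⟩
  · exact ⟨(perm_range n w hw _ (by omega)).2, (perm_range n w hw _ (by omega)).2⟩

lemma pos_inv_le_val (n k : ℕ) (w : Equiv.Perm ℕ) (hw : IsPermOf n w) :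
    posPairCount n k w⁻¹ ≤ valPairCount n k w := by
  classical
  have hex : ∀ a, ∃ g, IsPosPair n k w⁻¹ a → PairRel n w⁻¹ a g := by
    intro a
    by_cases h : IsPosPair n k w⁻¹ a
    · obtain ⟨g, hg⟩ := rel_exists n k _ a h
      exact ⟨g, fun _ => hg⟩
    · exact ⟨a, fun h' => absurd h' h⟩
  choose f hf using hex
  apply Set.ncard_le_ncard_of_injOn f _ _ (valPair_finite n k w hw)
  · intro a ha
    exact rel_val n k w hw a _ ha (hf a ha)
  · intro a ha b hb hab
    exact rel_inj n k _ a b (f a) ha hb (hf a ha) (hab ▸ hf b hb)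

/-- Theorem: maximal repetition. For `n ≥ 2`, `w ∈ S_n`, and
`k ∈ {1,…,n-1}`, `max_k(w) ≤ min{ValPair_k(w), PosPair_k(w)} + 1`. -/
theorem maxOcc_le_min_pairs (n : ℕ) (hn : 2 ≤ n) (w : Equiv.Perm ℕ)
    (hw : IsPermOf n w) (k : ℕ) (hk1 : 1 ≤ k) (hk2 : k ≤ n - 1) :
    maxOcc n k w ≤ min (valPairCount n k w) (posPairCount n k w) + 1 := by
  apply csSup_le'
  rintro m ⟨L, ⟨⟨hL, hprod⟩, hlen⟩, rfl⟩
  have hpos := (count_le_pos n k hk1 hk2 L hL (by rw [hprod]; exact hlen)).1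
  rw [hprod] at hpos
  have hrev : (L.reverse.map simpleRefl).prod = w⁻¹ := by
    rw [← hprod, List.prod_inv_reverse, List.map_map, List.map_reverse]
    congr 2
  have hl1 := len_le_inv n w hw
  have hl2 := len_le_inv n _ (perm_inv n w hw)
  rw [inv_inv] at hl2
  have hval := (count_le_pos n k hk1 hk2 L.reverse (by simpa using hL)
    (by rw [hrev, List.length_reverse]; omega)).1
  rw [hrev, List.count_reverse] at hval
  have := pos_inv_le_val n k w hw
  omega
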